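/- Assume every x ∈ X satisfies ‖x‖₀ = p for a fixed integer p ≥ 1. Let ε > 0 and let q ∈ (0,1] be such that q·n is a positive integer and q ≥ (M_∞/m_∞)/(ε + M_∞/m_∞). Then opt(n) ≤ opt(q·n) ≤ (1+ε)·opt(n). -/

import Mathlib

open scoped BigOperators

/-- Dot product of two vectors in `ℝ^ν`. -/
noncomputable def dot {ν : ℕ} (c x : Fin ν → ℝ) : ℝ := ∑ j, c j * x j

/-- `convComb X k` is the set `X(k)` of all convex combinations of at most `k` points of `X`. -/
def convComb {ν : ℕ} (X : Set (Fin ν → ℝ)) (k : ℕ) : Set (Fin ν → ℝ) :=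
  { x | ∃ (xs : Fin k → (Fin ν → ℝ)) (lam : Fin k → ℝ),
      (∀ i, xs i ∈ X) ∧ (∀ i, 0 ≤ lam i) ∧ (∑ i, lam i) = 1 ∧
      x = ∑ i, lam i • xs i }

/-- The worst-case objective `max_{c ∈ U} cᵀx`. -/
noncomputable def objSup {ν : ℕ} (U : Set (Fin ν → ℝ)) (x : Fin ν → ℝ) : ℝ :=
  sSup ((fun c => dot c x) '' U)

/-- `opt(k) = min_{x ∈ X(k)} max_{c ∈ U} cᵀx`. -/
noncomputable def optVal {ν : ℕ} (X U : Set (Fin ν → ℝ)) (k : ℕ) : ℝ :=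
  sInf (objSup U '' convComb X k)

/-- `‖x‖₀`, the number of nonzero entries of `x`, as a real number. -/
noncomputable def zeroNorm {ν : ℕ} (x : Fin ν → ℝ) : ℝ :=
  ((Finset.univ.filter (fun j => x j ≠ 0)).card : ℝ)

/-- The min-max-min robust value over `k`-tuples of feasible solutions:
`min_{x¹,…,x^k ∈ X} max_{c ∈ U} min_{i} cᵀxⁱ`. -/
noncomputable def minmaxVal {ν : ℕ} (X U : Set (Fin ν → ℝ)) (k : ℕ) : ℝ :=
  sInf { v : ℝ | ∃ xs : Fin k → (Fin ν → ℝ), (∀ i, xs i ∈ X) ∧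
    v = sSup ((fun c => ⨅ i, dot c (xs i)) '' U) }

/-- `app(k)`, the objective value of the `k` solutions `x¹,…,x^k` with largest weights
returned by Algorithm 1: `max_{c ∈ U} min_{i=1,…,k} cᵀxⁱ`. -/
noncomputable def appVal {ν : ℕ} (U : Set (Fin ν → ℝ)) (xs : Fin ν → (Fin ν → ℝ)) (k : ℕ) : ℝ :=
  sSup ((fun c => ⨅ i : {i : Fin ν // (i : ℕ) < k}, dot c (xs i.1)) '' U)

/-- Some `k` elements of `s` carry at least the average share `k / #s` of a weight on `s`. -/
theorem Finset.exists_subset_card_mul_sum_le {ι : Type*} (f : ι → ℝ) {k : ℕ} (hk : 0 < k)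
    (s : Finset ι) (hks : k ≤ s.card) :
    ∃ t ⊆ s, t.card = k ∧ (k : ℝ) * ∑ i ∈ s, f i ≤ s.card * ∑ i ∈ t, f i := by
  classical
  induction s using Finset.strongInduction with
  | H s ih =>
    rcases hks.eq_or_lt with h | h
    · exact ⟨s, Finset.Subset.refl s, h.symm, by rw [h]⟩
    obtain ⟨m, hm, hmin⟩ := s.exists_min_image f (Finset.card_pos.mp (by omega))
    have hcard : (s.erase m).card + 1 = s.card := Finset.card_erase_add_one hm
    obtain ⟨t, hts, htk, ht⟩ := ih (s.erase m) (Finset.erase_ssubset hm) (by omega)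
    refine ⟨t, hts.trans (Finset.erase_subset m s), htk, ?_⟩
    have hsum : ∑ i ∈ s.erase m, f i + f m = ∑ i ∈ s, f i := Finset.sum_erase_add s f hm
    have hmean : (s.card : ℝ) * f m ≤ ∑ i ∈ s, f i := by
      simpa using Finset.card_nsmul_le_sum s f (f m) hmin
    have hcardR : ((s.erase m).card : ℝ) + 1 = s.card := by exact_mod_cast hcard
    have hpos : (0 : ℝ) < (s.erase m).card := by
      have : 0 < (s.erase m).card := by omega
      exact_mod_cast this
    rw [← hcardR] at hmean ⊢
    rw [← hsum] at hmean ⊢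
    refine le_of_mul_le_mul_left ?_ hpos
    have hmean' : ((s.erase m).card : ℝ) * f m ≤ ∑ i ∈ s.erase m, f i := by linarith
    have hmul := mul_le_mul_of_nonneg_left hmean' (Nat.cast_nonneg (α := ℝ) k)
    have hmul' := mul_le_mul_of_nonneg_left ht hpos.le
    linarith

theorem dot_nonneg {ν : ℕ} {c x : Fin ν → ℝ} (hc : ∀ j, 0 ≤ c j) (hx : ∀ j, 0 ≤ x j) :
    0 ≤ dot c x :=
  Finset.sum_nonneg fun j _ => mul_nonneg (hc j) (hx j)

theorem dot_le_dot {ν : ℕ} {c x y : Fin ν → ℝ} (hc : ∀ j, 0 ≤ c j) (hxy : ∀ j, x j ≤ y j) :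
    dot c x ≤ dot c y :=
  Finset.sum_le_sum fun j _ => mul_le_mul_of_nonneg_left (hxy j) (hc j)

theorem dot_smul_right {ν : ℕ} (a : ℝ) (c x : Fin ν → ℝ) : dot c (a • x) = a * dot c x := by
  simp only [dot, Finset.mul_sum, Pi.smul_apply, smul_eq_mul]
  exact Finset.sum_congr rfl fun j _ => by ring

theorem bddAbove_image_dot {ν : ℕ} {U : Set (Fin ν → ℝ)} (hU : IsCompact U) (x : Fin ν → ℝ) :
    BddAbove ((fun c => dot c x) '' U) :=
  (hU.image (by unfold dot; fun_prop)).bddAbove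

theorem objSup_nonneg {ν : ℕ} {U : Set (Fin ν → ℝ)} {x : Fin ν → ℝ}
    (hU : ∀ c ∈ U, ∀ j, 0 ≤ c j) (hx : ∀ j, 0 ≤ x j) : 0 ≤ objSup U x := by
  refine Real.sSup_nonneg ?_
  rintro _ ⟨c, hc, rfl⟩
  exact dot_nonneg (hU c hc) hx

theorem objSup_le_mul_of_le_smul {ν : ℕ} {U : Set (Fin ν → ℝ)} (hUne : U.Nonempty)
    (hUcomp : IsCompact U) (hU : ∀ c ∈ U, ∀ j, 0 ≤ c j) {a : ℝ} (ha : 0 ≤ a)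
    {x y : Fin ν → ℝ} (hxy : ∀ j, x j ≤ (a • y) j) : objSup U x ≤ a * objSup U y := by
  refine csSup_le (hUne.image _) ?_
  rintro _ ⟨c, hc, rfl⟩
  calc dot c x ≤ dot c (a • y) := dot_le_dot (hU c hc) hxy
    _ = a * dot c y := dot_smul_right a c y
    _ ≤ a * objSup U y :=
      mul_le_mul_of_nonneg_left (le_csSup (bddAbove_image_dot hUcomp y) ⟨c, hc, rfl⟩) ha

theorem convComb_nonneg {ν k : ℕ} {X : Set (Fin ν → ℝ)} (hX : ∀ x ∈ X, ∀ j, 0 ≤ x j)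
    {x : Fin ν → ℝ} (hx : x ∈ convComb X k) (j : Fin ν) : 0 ≤ x j := by
  obtain ⟨xs, lam, hxs, hlam, -, rfl⟩ := hx
  rw [Finset.sum_apply]
  exact Finset.sum_nonneg fun i _ => mul_nonneg (hlam i) (hX _ (hxs i) j)

theorem convComb_nonempty {ν k : ℕ} {X : Set (Fin ν → ℝ)} (hX : X.Nonempty) (hk : 0 < k) :
    (convComb X k).Nonempty := by
  obtain ⟨x, hx⟩ := hX
  have hk' : (k : ℝ) ≠ 0 := by exact_mod_cast hk.ne'
  exact ⟨_, fun _ => x, fun _ => (k : ℝ)⁻¹, fun _ => hx, fun _ => by positivity,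
    by simp [hk'], rfl⟩

theorem convComb_mono {ν k l : ℕ} {X : Set (Fin ν → ℝ)} (hX : X.Nonempty) (hkl : k ≤ l) :
    convComb X k ⊆ convComb X l := by
  obtain ⟨d, rfl⟩ := Nat.exists_eq_add_of_le hkl
  obtain ⟨x₀, hx₀⟩ := hX
  rintro x ⟨xs, lam, hxs, hlam, hsum, rfl⟩
  refine ⟨Fin.append xs fun _ => x₀, Fin.append lam fun _ => 0, fun i => ?_, fun i => ?_, ?_, ?_⟩
  · refine Fin.addCases (fun i => ?_) (fun i => ?_) i
    · simpa using hxs i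
    · simpa using hx₀
  · refine Fin.addCases (fun i => ?_) (fun i => ?_) i
    · simpa using hlam i
    · simp
  · simpa [Fin.sum_univ_add] using hsum
  · simp [Fin.sum_univ_add]

/-- Keeping the `k` largest of `l` weights and renormalizing scales a nonnegative convex
combination by at most `l / k`. -/
theorem exists_mem_convComb_le_smul {ν k l : ℕ} {X : Set (Fin ν → ℝ)}
    (hX : ∀ x ∈ X, ∀ j, 0 ≤ x j) (hk : 0 < k) (hkl : k ≤ l) {y : Fin ν → ℝ}
    (hy : y ∈ convComb X l) :
    ∃ z ∈ convComb X k, ∀ j, z j ≤ (((l : ℝ) / k) • y) j := by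
  obtain ⟨xs, lam, hxs, hlam, hsum, rfl⟩ := hy
  obtain ⟨t, -, htk, ht⟩ :=
    Finset.exists_subset_card_mul_sum_le lam hk Finset.univ (by simpa using hkl)
  rw [hsum, mul_one, Finset.card_univ, Fintype.card_fin] at ht
  have hkR : (0 : ℝ) < k := by exact_mod_cast hk
  have hlR : (0 : ℝ) < l := by exact_mod_cast hk.trans_le hkl
  set L := ∑ i ∈ t, lam i with hL
  have hLpos : 0 < L := pos_of_mul_pos_right (hkR.trans_le ht) hlR.le
  have hinv : L⁻¹ ≤ (l : ℝ) / k := by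
    rw [inv_le_iff_one_le_mul₀ hLpos, div_mul_eq_mul_div, one_le_div hkR]
    exact ht
  let e := t.equivFinOfCardEq htk
  refine ⟨L⁻¹ • ∑ i ∈ t, lam i • xs i, ⟨fun i => xs (e.symm i), fun i => L⁻¹ * lam (e.symm i),
    fun i => hxs _, fun i => mul_nonneg (inv_nonneg.mpr hLpos.le) (hlam _), ?_, ?_⟩, fun j => ?_⟩
  · rw [← Finset.mul_sum, Equiv.sum_comp e.symm fun i : t => lam i, Finset.sum_coe_sort t lam,
      ← hL, inv_mul_cancel₀ hLpos.ne']
  · simp only [mul_smul]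
    rw [← Finset.smul_sum, Equiv.sum_comp e.symm fun i : t => lam i • xs i,
      Finset.sum_coe_sort t fun i => lam i • xs i]
  · have hterm : ∀ i, 0 ≤ (lam i • xs i) j := fun i => mul_nonneg (hlam i) (hX _ (hxs i) j)
    simp only [Pi.smul_apply _ (Finset.sum _ _), smul_eq_mul, Finset.sum_apply j]
    exact mul_le_mul hinv
      (Finset.sum_le_sum_of_subset_of_nonneg (Finset.subset_univ t) fun i _ _ => hterm i)
      (Finset.sum_nonneg fun i _ => hterm i) (by positivity)

/-- Assume every `x ∈ X` satisfies `‖x‖₀ = p` for a fixed integer `p ≥ 1`.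
Let `ε > 0` and `q ∈ (0,1]` with `q·n` a positive integer and
`q ≥ (M_∞/m_∞)/(ε + M_∞/m_∞)`. Then `opt(n) ≤ opt(q·n) ≤ (1+ε)·opt(n)`. -/
theorem stmt12 (n : ℕ) (hn : 0 < n)
    (X : Set (Fin n → ℝ)) (hXfin : X.Finite) (hXne : X.Nonempty)
    (hXbin : ∀ x ∈ X, ∀ j, x j = 0 ∨ x j = 1)
    (U : Set (Fin n → ℝ)) (hUne : U.Nonempty) (hUcomp : IsCompact U) (hUconv : Convex ℝ U)
    (m_inf M_inf : ℝ) (hminf : 0 < m_inf) (hmM : m_inf ≤ M_inf)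
    (hc : ∀ c ∈ U, ∀ j, m_inf ≤ c j ∧ c j ≤ M_inf)
    (p : ℕ) (hp : 1 ≤ p) (hpx : ∀ x ∈ X, zeroNorm x = (p : ℝ))
    (ε : ℝ) (hε : 0 < ε) (q : ℝ) (hq0 : 0 < q) (hq1 : q ≤ 1)
    (k : ℕ) (hkpos : 0 < k) (hkq : (k : ℝ) = q * (n : ℝ))
    (hqbound : (M_inf / m_inf) / (ε + M_inf / m_inf) ≤ q) :
    optVal X U n ≤ optVal X U k ∧ optVal X U k ≤ (1 + ε) * optVal X U n := by
  have hr : 1 ≤ M_inf / m_inf := (one_le_div hminf).mpr hmM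
  have hnR : (0 : ℝ) < n := by exact_mod_cast hn
  have hkR : (0 : ℝ) < k := by exact_mod_cast hkpos
  have hkn : k ≤ n := by
    have : (k : ℝ) ≤ n := by rw [hkq]; exact mul_le_of_le_one_left hnR.le hq1
    exact_mod_cast this
  have hratio : (n : ℝ) / k ≤ 1 + ε := by
    rw [div_le_iff₀ (by positivity)] at hqbound
    have h1 : 1 ≤ (1 + ε) * q := by nlinarith
    rw [div_le_iff₀ hkR, hkq]
    nlinarith
  have hX : ∀ x ∈ X, ∀ j, 0 ≤ x j := fun x hx j => by
    rcases hXbin x hx j with h | h <;> simp [h]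
  have hU : ∀ c ∈ U, ∀ j, 0 ≤ c j := fun c hcU j => hminf.le.trans (hc c hcU j).1
  have hbdd : ∀ l, BddBelow (objSup U '' convComb X l) := by
    refine fun l => ⟨0, ?_⟩
    rintro _ ⟨x, hx, rfl⟩
    exact objSup_nonneg hU (convComb_nonneg hX hx)
  refine ⟨csInf_le_csInf (hbdd n) ((convComb_nonempty hXne hkpos).image _)
    (Set.image_mono (convComb_mono hXne hkn)), ?_⟩
  rw [← div_le_iff₀' (by positivity)]
  refine le_csInf ((convComb_nonempty hXne hn).image _) ?_
  rintro _ ⟨y, hy, rfl⟩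
  rw [div_le_iff₀' (by positivity)]
  obtain ⟨z, hz, hzy⟩ := exists_mem_convComb_le_smul hX hkpos hkn hy
  calc optVal X U k ≤ objSup U z := csInf_le (hbdd k) ⟨z, hz, rfl⟩
    _ ≤ (n : ℝ) / k * objSup U y :=
      objSup_le_mul_of_le_smul hUne hUcomp hU (by positivity) hzy
    _ ≤ (1 + ε) * objSup U y :=
      mul_le_mul_of_nonneg_right hratio (objSup_nonneg hU (convComb_nonneg hX hy))
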